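/- arXiv:1503.06286 — 2 statements merged into one kernel-verified Lean document; each statement's English description precedes it below -/
import Mathlib

section
/- Let G be a connected k-regular finite simple graph on v vertices with girth g, and suppose G has exactly d+1 distinct adjacency eigenvalues. If g ≥ 2d, then the second largest adjacency eigenvalue of G is minimal among all connected k-regular graphs on v vertices: λ₂(G) ≤ λ₂(H) for every connected k-regular finite simple graph H on v vertices. -/
open Polynomial

/-- The adjacency matrix of a simple graph over `ℝ` is Hermitian. -/
theorem adjMatrix_isHermitian {V : Type*} [Fintype V] [DecidableEq V]
    (G : SimpleGraph V) [DecidableRel G.Adj] : (G.adjMatrix ℝ).IsHermitian := by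
  rw [Matrix.IsHermitian, Matrix.conjTranspose_eq_transpose_of_trivial]
  exact G.isSymm_adjMatrix

/-- The multiset of adjacency eigenvalues (with multiplicity) of a finite simple graph. -/
noncomputable def eigMultiset {V : Type*} [Fintype V] [DecidableEq V]
    (G : SimpleGraph V) [DecidableRel G.Adj] : Multiset ℝ :=
  Multiset.map (adjMatrix_isHermitian G).eigenvalues Finset.univ.val

/-- The second largest adjacency eigenvalue (with multiplicity) of a finite simple graph:
the second-to-last entry of the nondecreasing sorted list of eigenvalues. -/
noncomputable def secondEigenvalue {V : Type*} [Fintype V] [DecidableEq V]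
    (G : SimpleGraph V) [DecidableRel G.Adj] : ℝ :=
  ((eigMultiset G).sort (· ≤ ·)).getD (((eigMultiset G).sort (· ≤ ·)).length - 2) 0

/-- The largest adjacency eigenvalue (spectral radius) of a finite simple graph. -/
noncomputable def largestEigenvalue {V : Type*} [Fintype V] [DecidableEq V]
    (G : SimpleGraph V) [DecidableRel G.Adj] : ℝ :=
  ((eigMultiset G).sort (· ≤ ·)).getD (((eigMultiset G).sort (· ≤ ·)).length - 1) 0

/-- The orthogonal polynomials `F_i^{(k)}`. -/
noncomputable def Fpoly (k : ℕ) : ℕ → Polynomial ℝ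
  | 0 => 1
  | 1 => X
  | 2 => X ^ 2 - C (k : ℝ)
  | n + 3 => X * Fpoly k (n + 2) - C ((k : ℝ) - 1) * Fpoly k (n + 1)

/-- `G_i = Σ_{j=0}^i F_j`. -/
noncomputable def Gpoly (k : ℕ) (i : ℕ) : Polynomial ℝ :=
  ∑ j ∈ Finset.range (i + 1), Fpoly k j

/-- The tridiagonal matrix `T(k,t,c)`: superdiagonal `(k, k-1, …, k-1)`,
subdiagonal `(1, …, 1, c)`, diagonal chosen so that every row sums to `k`. -/
noncomputable def Tmat (k t : ℕ) (c : ℝ) : Matrix (Fin t) (Fin t) ℝ :=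
  Matrix.of fun i j =>
    if (j : ℕ) = (i : ℕ) + 1 then (if (i : ℕ) = 0 then (k : ℝ) else (k : ℝ) - 1)
    else if (i : ℕ) = (j : ℕ) + 1 then (if (i : ℕ) = t - 1 then c else 1)
    else if i = j then
      (k : ℝ) - (if (i : ℕ) + 1 < t then (if (i : ℕ) = 0 then (k : ℝ) else (k : ℝ) - 1) else 0)
        - (if 0 < (i : ℕ) then (if (i : ℕ) = t - 1 then c else 1) else 0)
    else 0

/-- `M(k,t,c) = 1 + Σ_{i=0}^{t-3} k (k-1)^i + k (k-1)^{t-2} / c`. -/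
noncomputable def Mbound (k t : ℕ) (c : ℝ) : ℝ :=
  1 + (∑ i ∈ Finset.range (t - 2), (k : ℝ) * ((k : ℝ) - 1) ^ i)
    + (k : ℝ) * ((k : ℝ) - 1) ^ (t - 2) / c


lemma Fpoly_succ_succ (k n : ℕ) :
    Fpoly k (n + 2) =
      X * Fpoly k (n + 1) - C (if n = 0 then (k : ℝ) else (k : ℝ) - 1) * Fpoly k n := by
  cases n with
  | zero => simp [Fpoly, pow_two]
  | succ n => simp [Fpoly]

lemma Fpoly_monic_natDegree (k n : ℕ) : (Fpoly k n).Monic ∧ (Fpoly k n).natDegree = n := by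
  induction n using Nat.strong_induction_on with
  | _ n ih =>
    match n with
    | 0 => simp [Fpoly]
    | 1 => simp [Fpoly, monic_X]
    | n + 2 =>
      obtain ⟨hm, hn⟩ := ih (n + 1) (by omega)
      obtain ⟨-, hn'⟩ := ih n (by omega)
      have hX : (X * Fpoly k (n + 1)).Monic := monic_X.mul hm
      have hXd : (X * Fpoly k (n + 1)).natDegree = n + 2 := by
        rw [monic_X.natDegree_mul hm, hn, natDegree_X]; ring
      have hlt : (C (if n = 0 then (k : ℝ) else (k : ℝ) - 1) * Fpoly k n).natDegree
          < (X * Fpoly k (n + 1)).natDegree := by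
        have := natDegree_C_mul_le (if n = 0 then (k : ℝ) else (k : ℝ) - 1) (Fpoly k n)
        omega
      rw [Fpoly_succ_succ]
      exact ⟨hX.sub_of_left (degree_lt_degree hlt),
        by rw [natDegree_sub_eq_left_of_natDegree_lt hlt, hXd]⟩

/-- A graded family of monic polynomials spans all polynomials. -/
lemma exists_eq_sum_of_monic {P : ℕ → ℝ[X]} (hP : ∀ n, (P n).Monic ∧ (P n).natDegree = n)
    (m : ℕ) (p : ℝ[X]) (hp : p.natDegree ≤ m) :
    ∃ c : ℕ → ℝ, c m = p.coeff m ∧ p = ∑ i ∈ Finset.range (m + 1), C (c i) * P i := by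
  induction m generalizing p with
  | zero =>
    have h0 : P 0 = 1 := (hP 0).1.natDegree_eq_zero.1 (hP 0).2
    exact ⟨fun _ => p.coeff 0, rfl, by
      simpa [h0] using eq_C_of_natDegree_le_zero hp⟩
  | succ m ih =>
    have hlead : (P (m + 1)).coeff (m + 1) = 1 := by
      have := (hP (m + 1)).1.coeff_natDegree
      rwa [(hP (m + 1)).2] at this
    have hdeg : (p - C (p.coeff (m + 1)) * P (m + 1)).natDegree ≤ m := by
      rw [natDegree_le_iff_coeff_eq_zero]
      intro N hN
      rcases Nat.lt_or_ge (m + 1) N with h | h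
      · have h' : (P (m + 1)).natDegree < N := by rw [(hP _).2]; exact h
        simp [coeff_eq_zero_of_natDegree_lt (hp.trans_lt h), coeff_eq_zero_of_natDegree_lt h']
      · obtain rfl : N = m + 1 := by omega
        simp [hlead]
    obtain ⟨c, -, hc⟩ := ih _ hdeg
    refine ⟨fun i => if i = m + 1 then p.coeff (m + 1) else c i, by simp, ?_⟩
    rw [Finset.sum_range_succ]
    simp only [if_true]
    rw [Finset.sum_congr rfl (g := fun i => C (c i) * P i), ← hc]
    · ring
    · intro i hi
      rw [if_neg (by have := Finset.mem_range.1 hi; omega)]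

lemma Gpoly_monic_natDegree (k n : ℕ) : (Gpoly k n).Monic ∧ (Gpoly k n).natDegree = n := by
  obtain ⟨hm, hd⟩ := Fpoly_monic_natDegree k n
  unfold Gpoly
  rw [Finset.sum_range_succ, add_comm]
  have hlt : (∑ j ∈ Finset.range n, Fpoly k j).degree < (Fpoly k n).degree := by
    rw [degree_eq_natDegree hm.ne_zero, hd]
    refine (degree_sum_le _ _).trans_lt ((Finset.sup_lt_iff (WithBot.bot_lt_coe n)).2 ?_)
    intro j hj
    obtain ⟨hm', hd'⟩ := Fpoly_monic_natDegree k j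
    rw [degree_eq_natDegree hm'.ne_zero, hd']
    exact Nat.cast_lt.2 (Finset.mem_range.1 hj)
  exact ⟨hm.add_of_left hlt, by rw [natDegree_add_eq_left_of_degree_lt hlt, hd]⟩

/-- A functional vanishing on `F_1, …, F_M` makes the `F_i` orthogonal. -/
lemma functional_Fpoly_mul {k M : ℕ} {v : ℝ} (L : ℝ[X] →ₗ[ℝ] ℝ) (h0 : L 1 = v)
    (hL : ∀ n, 1 ≤ n → n ≤ M → L (Fpoly k n) = 0) (i j : ℕ) (hij : i + j ≤ M) :
    L (Fpoly k i * Fpoly k j) = if i = j then v * (Fpoly k i).eval (k : ℝ) else 0 := by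
  have hC (c : ℝ) (p : ℝ[X]) : L (C c * p) = c * L p := by
    rw [← smul_eq_C_mul, map_smul, smul_eq_mul]
  have hX (m : ℕ) : ∀ n, m < n → m + n ≤ M → L (X ^ m * Fpoly k n) = 0 := by
    induction m with
    | zero => intro n hn hM; simpa using hL n hn (by omega)
    | succ m ih =>
      intro n hn hM
      obtain ⟨n, rfl⟩ : ∃ l, n = l + 2 := ⟨n - 2, by omega⟩
      have h := Fpoly_succ_succ k (n + 1)
      have : X ^ (m + 1) * Fpoly k (n + 2) = X ^ m * Fpoly k (n + 1 + 2)
          + C (if n + 1 = 0 then (k : ℝ) else (k : ℝ) - 1) * (X ^ m * Fpoly k (n + 1)) := by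
        rw [h]; ring
      rw [this, map_add, hC, ih _ (by omega) (by omega), ih _ (by omega) (by omega)]
      simp
  have hlt (r : ℝ[X]) (n : ℕ) (hr : r.natDegree < n) (hM : r.natDegree + n ≤ M) :
      L (r * Fpoly k n) = 0 := by
    conv_lhs => rw [r.as_sum_range_C_mul_X_pow, Finset.sum_mul, map_sum]
    refine Finset.sum_eq_zero fun m hm => ?_
    have := Finset.mem_range.1 hm
    rw [mul_assoc, hC, hX m n (by omega) (by omega), mul_zero]
  have hsq (n : ℕ) : 2 * n ≤ M → L (Fpoly k n * Fpoly k n) = v * (Fpoly k n).eval (k : ℝ) := by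
    induction n with
    | zero => intro _; simp [Fpoly, h0]
    | succ n ih =>
      intro hM
      cases n with
      | zero =>
        have h2 : Fpoly k (0 + 1) * Fpoly k (0 + 1) = Fpoly k 2 + C (k : ℝ) * 1 := by
          simp [Fpoly, pow_two]
        rw [h2, map_add, hC, hL 2 (by omega) (by omega), h0]
        simp [Fpoly, mul_comm]
      | succ n =>
        have e1 := Fpoly_succ_succ k n
        have e2 := Fpoly_succ_succ k (n + 1)
        have h2 : Fpoly k (n + 2) * Fpoly k (n + 2) = Fpoly k (n + 1) * Fpoly k (n + 3)
            + C (if n + 1 = 0 then (k : ℝ) else (k : ℝ) - 1) * (Fpoly k (n + 1) * Fpoly k (n + 1))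
            - C (if n = 0 then (k : ℝ) else (k : ℝ) - 1) * (Fpoly k n * Fpoly k (n + 2)) := by
          rw [e2]
          nth_rewrite 1 [e1]
          ring
        have hev : (Fpoly k (n + 2)).eval (k : ℝ) = ((k : ℝ) - 1) * (Fpoly k (n + 1)).eval (k : ℝ) := by
          clear e1 e2 h2 ih hM
          induction n with
          | zero => simp [Fpoly]; ring
          | succ n ih =>
            rw [Fpoly_succ_succ]
            simp [ih]; ring
        have d1 := (Fpoly_monic_natDegree k n).2
        have d2 := (Fpoly_monic_natDegree k (n + 1)).2
        rw [h2, map_sub, map_add, hC, hC, ih (by omega), hlt _ _ (by omega) (by omega),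
          hlt _ _ (by omega) (by omega), hev]
        simp
        ring
  have di := (Fpoly_monic_natDegree k i).2
  have dj := (Fpoly_monic_natDegree k j).2
  rcases lt_trichotomy i j with h | rfl | h
  · rw [hlt _ _ (by omega) (by omega), if_neg (by omega)]
  · rw [if_pos rfl, hsq i (by omega)]
  · rw [mul_comm, hlt _ _ (by omega) (by omega), if_neg (by omega)]

section Graph

variable {V : Type*} [Fintype V] [DecidableEq V] (G : SimpleGraph V) [DecidableRel G.Adj]

/-- The number of non-backtracking walks of length `n + 1` from `u` to `y` whose
penultimate vertex is `x`. -/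
def nonBacktrackingCount (u : V) : ℕ → V → V → ℕ
  | 0, x, y => if u = x ∧ G.Adj x y then 1 else 0
  | n + 1, y, z => if G.Adj y z then ∑ x ∈ Finset.univ.erase z, nonBacktrackingCount u n x y else 0

variable {G}

lemma adj_of_nonBacktrackingCount_ne_zero {u : V} {n : ℕ} {x y : V}
    (h : nonBacktrackingCount G u n x y ≠ 0) : G.Adj x y := by
  by_contra hxy
  cases n <;> simp [nonBacktrackingCount, hxy] at h

/-- Below the girth, non-backtracking walks are paths. -/
lemma exists_isPath_of_nonBacktrackingCount_ne_zero {u : V} {n : ℕ} {x y : V}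
    (hn : ((n + 1 : ℕ) : ℕ∞) < G.egirth) (h : nonBacktrackingCount G u n x y ≠ 0) :
    ∃ (hyx : G.Adj y x) (p : G.Walk x u), (p.cons hyx).IsPath ∧ p.length = n := by
  induction n generalizing x y with
  | zero =>
    have : u = x ∧ G.Adj x y := by
      by_contra hc; simp [nonBacktrackingCount, hc] at h
    obtain ⟨rfl, hxy⟩ := this
    exact ⟨hxy.symm, .nil, by simp [SimpleGraph.Walk.cons_isPath_iff, hxy.ne'], rfl⟩
  | succ n ih =>
    have hadj := adj_of_nonBacktrackingCount_ne_zero h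
    simp only [nonBacktrackingCount, hadj, if_true] at h
    obtain ⟨w, hw, hne⟩ := Finset.exists_ne_zero_of_sum_ne_zero h
    obtain ⟨hxw, p, hp, hlen⟩ := ih (lt_of_le_of_lt (by exact_mod_cast Nat.le_succ _) hn) hne
    refine ⟨hadj.symm, p.cons hxw, ?_, by simp [hlen]⟩
    rw [SimpleGraph.Walk.cons_isPath_iff]
    refine ⟨hp, fun hmem => ?_⟩
    have hcyc : (((p.cons hxw).takeUntil y hmem).cons hadj.symm).IsCycle := by
      rw [SimpleGraph.Walk.cons_isCycle_iff]
      refine ⟨hp.takeUntil hmem, fun he => ?_⟩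
      have he' := SimpleGraph.Walk.edges_takeUntil_subset_edges _ hmem he
      rw [SimpleGraph.Walk.edges_cons, List.mem_cons] at he'
      rcases he' with he' | he'
      · have hyw : y ≠ w := (Finset.ne_of_mem_erase hw).symm
        rw [Sym2.eq_iff] at he'
        rcases he' with ⟨h1, -⟩ | ⟨h1, -⟩
        · exact hadj.ne' h1
        · exact hyw h1
      · exact ((SimpleGraph.Walk.cons_isPath_iff _ _).1 hp).2
          (SimpleGraph.Walk.snd_mem_support_of_mem_edges _ he')
    have h1 := SimpleGraph.egirth_le_length hcyc
    have h2 := SimpleGraph.Walk.length_takeUntil_le_length (p.cons hxw) hmem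
    have h3 : ((p.cons hxw).takeUntil y hmem).length + 1 ≤ n + 1 + 1 := by
      rw [SimpleGraph.Walk.length_cons] at h2; omega
    rw [SimpleGraph.Walk.length_cons] at h1
    exact absurd (h1.trans (by exact_mod_cast h3)) (not_le.2 hn)

lemma aeval_Fpoly_succ_apply {k : ℕ} (hreg : G.IsRegularOfDegree k) (n : ℕ) (u y : V) :
    aeval (G.adjMatrix ℝ) (Fpoly k (n + 1)) u y =
      ((∑ x, nonBacktrackingCount G u n x y : ℕ) : ℝ) := by
  have hdeg (z : V) : ((G.neighborFinset z).card : ℝ) = k := by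
    rw [SimpleGraph.card_neighborFinset_eq_degree, hreg z]
  induction n using Nat.strong_induction_on generalizing y with
  | _ n ih =>
  match n with
  | 0 => simp [Fpoly, nonBacktrackingCount, SimpleGraph.adjMatrix_apply, ite_and]
  | n + 1 =>
    have hback (z : V) : ∑ y ∈ G.neighborFinset z, (nonBacktrackingCount G u n z y : ℝ) =
        (if n = 0 then (k : ℝ) else (k : ℝ) - 1) * aeval (G.adjMatrix ℝ) (Fpoly k n) u z := by
      cases n with
      | zero =>
        rw [Finset.sum_congr rfl (g := fun _ => if u = z then (1 : ℝ) else 0)]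
        · simp [Fpoly, Matrix.one_apply, hreg z]
        · intro y hy
          rw [SimpleGraph.mem_neighborFinset] at hy
          simp [nonBacktrackingCount, hy]
      | succ n =>
        have h1 : ∀ y ∈ G.neighborFinset z, (nonBacktrackingCount G u (n + 1) z y : ℝ) =
            ∑ x, (nonBacktrackingCount G u n x z : ℝ) - nonBacktrackingCount G u n y z := by
          intro y hy
          rw [SimpleGraph.mem_neighborFinset] at hy
          simp only [nonBacktrackingCount, hy, if_true]
          rw [← Finset.sum_erase_add _ _ (Finset.mem_univ y)]
          push_cast; ring
        have h2 : ∑ y ∈ G.neighborFinset z, (nonBacktrackingCount G u n y z : ℝ) =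
            ∑ x, (nonBacktrackingCount G u n x z : ℝ) := by
          refine Finset.sum_subset (Finset.subset_univ _) fun y _ hy => ?_
          by_contra hc
          exact hy ((G.mem_neighborFinset _ _).2
            (adj_of_nonBacktrackingCount_ne_zero (by exact_mod_cast hc)).symm)
        rw [Finset.sum_congr rfl h1, Finset.sum_sub_distrib, h2, ih n (by omega)]
        simp [hreg z]
        ring
    rw [Fpoly_succ_succ, mul_comm X]
    simp only [map_sub, map_mul, aeval_X, aeval_C, Matrix.sub_apply,
      SimpleGraph.mul_adjMatrix_apply]
    rw [← Algebra.smul_def, Matrix.smul_apply, smul_eq_mul, ← hback,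
      Finset.sum_congr rfl fun x _ => ih n (by omega) x, ← Finset.sum_sub_distrib]
    push_cast
    rw [← Finset.sum_subset (Finset.subset_univ (G.neighborFinset y))]
    · refine Finset.sum_congr rfl fun x hx => ?_
      rw [SimpleGraph.mem_neighborFinset] at hx
      simp only [nonBacktrackingCount, hx.symm, if_true]
      rw [← Finset.sum_erase_add _ _ (Finset.mem_univ y)]
      push_cast; ring
    · intro x _ hx
      rw [SimpleGraph.mem_neighborFinset] at hx
      by_contra hc
      exact hx (adj_of_nonBacktrackingCount_ne_zero (by exact_mod_cast hc)).symm

lemma exists_aeval_Fpoly_apply_eq_natCast {k : ℕ} (hreg : G.IsRegularOfDegree k) (n : ℕ) (u y : V) :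
    ∃ c : ℕ, aeval (G.adjMatrix ℝ) (Fpoly k n) u y = c := by
  cases n with
  | zero => exact ⟨if u = y then 1 else 0, by simp [Fpoly, Matrix.one_apply]⟩
  | succ n => exact ⟨_, aeval_Fpoly_succ_apply hreg n u y⟩

lemma trace_aeval_Fpoly_of_lt_egirth {k : ℕ} (hreg : G.IsRegularOfDegree k) {n : ℕ} (hn : 1 ≤ n)
    (hg : (n : ℕ∞) < G.egirth) : (aeval (G.adjMatrix ℝ) (Fpoly k n)).trace = 0 := by
  obtain ⟨n, rfl⟩ : ∃ m, n = m + 1 := ⟨n - 1, by omega⟩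
  refine Finset.sum_eq_zero fun u _ => ?_
  rw [Matrix.diag_apply, aeval_Fpoly_succ_apply hreg, Nat.cast_eq_zero]
  refine Finset.sum_eq_zero fun x _ => ?_
  by_contra hc
  obtain ⟨h, p, hp, -⟩ := exists_isPath_of_nonBacktrackingCount_ne_zero hg hc
  simp at hp

lemma isSymm_aeval_adjMatrix (p : ℝ[X]) : (aeval (G.adjMatrix ℝ) p).IsSymm := by
  induction p using Polynomial.induction_on' with
  | add p q hp hq => rw [map_add]; exact hp.add hq
  | monomial n a =>
    rw [aeval_monomial, ← Algebra.smul_def]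
    exact (G.isSymm_adjMatrix.pow n).smul a

lemma aeval_adjMatrix_mulVec_one {k : ℕ} (hreg : G.IsRegularOfDegree k) (p : ℝ[X]) :
    (aeval (G.adjMatrix ℝ) p).mulVec 1 = p.eval (k : ℝ) • (1 : V → ℝ) := by
  have hA : (G.adjMatrix ℝ).mulVec 1 = (k : ℝ) • (1 : V → ℝ) := by
    ext v
    simp [SimpleGraph.adjMatrix_mulVec_apply, hreg v]
  induction p using Polynomial.induction_on with
  | C a => simp [Algebra.algebraMap_eq_smul_one, Matrix.smul_mulVec]
  | add p q hp hq => simp [Matrix.add_mulVec, hp, hq, add_smul]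
  | monomial n a h =>
    rw [pow_succ, ← mul_assoc, map_mul, aeval_X, ← Matrix.mulVec_mulVec, hA, Matrix.mulVec_smul, h,
      smul_smul]
    simp only [eval_mul, eval_C, eval_pow, eval_X]
    congr 1; ring

/-- The trace form of a regular graph dominates the orthogonal one on the `F_i`. -/
lemma le_trace_aeval_Fpoly_mul {k : ℕ} (hreg : G.IsRegularOfDegree k) (i j : ℕ) :
    (if i = j then (Fintype.card V : ℝ) * (Fpoly k i).eval (k : ℝ) else 0) ≤
      (aeval (G.adjMatrix ℝ) (Fpoly k i * Fpoly k j)).trace := by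
  have hnn (n : ℕ) (u y : V) : 0 ≤ aeval (G.adjMatrix ℝ) (Fpoly k n) u y := by
    obtain ⟨c, hc⟩ := exists_aeval_Fpoly_apply_eq_natCast hreg n u y
    rw [hc]; positivity
  simp only [map_mul, Matrix.trace, Matrix.diag_apply, Matrix.mul_apply]
  split_ifs with hij
  · subst hij
    have hrow (u : V) : ∑ y, aeval (G.adjMatrix ℝ) (Fpoly k i) u y = (Fpoly k i).eval (k : ℝ) := by
      have := congrFun (aeval_adjMatrix_mulVec_one hreg (Fpoly k i)) u
      simpa [Matrix.mulVec, dotProduct] using this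
    calc (Fintype.card V : ℝ) * (Fpoly k i).eval (k : ℝ)
        = ∑ u, ∑ y, aeval (G.adjMatrix ℝ) (Fpoly k i) u y := by simp [hrow]
      _ ≤ _ := by
        refine Finset.sum_le_sum fun u _ => Finset.sum_le_sum fun y _ => ?_
        rw [(isSymm_aeval_adjMatrix (Fpoly k i)).apply u y]
        obtain ⟨c, hc⟩ := exists_aeval_Fpoly_apply_eq_natCast hreg i u y
        rw [hc]
        exact_mod_cast Nat.le_mul_self c
  · exact Finset.sum_nonneg fun u _ => Finset.sum_nonneg fun y _ => mul_nonneg (hnn _ _ _) (hnn _ _ _)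

lemma trace_aeval_eq_sum_eigenvalues (p : ℝ[X]) :
    (aeval (G.adjMatrix ℝ) p).trace = ∑ i, p.eval ((adjMatrix_isHermitian G).eigenvalues i) := by
  conv_lhs => rw [(adjMatrix_isHermitian G).spectral_theorem]
  have h := aeval_algHom_apply
    (Unitary.conjStarAlgAut ℝ _ (adjMatrix_isHermitian G).eigenvectorUnitary)
    (Matrix.diagonalAlgHom ℝ (adjMatrix_isHermitian G).eigenvalues) p
  refine (congrArg Matrix.trace h).trans ?_
  rw [aeval_algHom_apply, Unitary.conjStarAlgAut_apply, Matrix.trace_mul_cycle,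
    Unitary.coe_star_mul_self, one_mul]
  simp [Matrix.trace, aeval_fn_apply]

/-- `k` is a simple eigenvalue of a connected `k`-regular graph and it is the largest one. -/
lemma exists_eigenvalues_eq_degree {k : ℕ} (hconn : G.Connected) (hreg : G.IsRegularOfDegree k) :
    ∃ i₀, (adjMatrix_isHermitian G).eigenvalues i₀ = k ∧
      ∀ i ≠ i₀, (adjMatrix_isHermitian G).eigenvalues i < k := by
  set hA := adjMatrix_isHermitian G
  obtain ⟨v₀⟩ := hconn.nonempty
  have hlap (x : V → ℝ) : (G.lapMatrix ℝ).mulVec x = (k : ℝ) • x - (G.adjMatrix ℝ).mulVec x := by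
    ext v
    simp [SimpleGraph.lapMatrix, Matrix.sub_mulVec, SimpleGraph.degMatrix_mulVec_apply, hreg v]
  have heig (i : V) : (G.lapMatrix ℝ).mulVec ⇑(hA.eigenvectorBasis i) =
      ((k : ℝ) - hA.eigenvalues i) • ⇑(hA.eigenvectorBasis i) := by
    rw [hlap, hA.mulVec_eigenvectorBasis, sub_smul]
  have hle (i : V) : hA.eigenvalues i ≤ k := by
    have h := (G.posSemidef_lapMatrix ℝ).dotProduct_mulVec_nonneg ⇑(hA.eigenvectorBasis i)
    rw [heig, dotProduct_smul, dotProduct_comm, ← EuclideanSpace.inner_eq_star_dotProduct,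
      real_inner_self_eq_norm_sq, hA.eigenvectorBasis.norm_eq_one] at h
    simpa using h
  have hconst (i : V) (hi : hA.eigenvalues i = k) (x y : V) :
      hA.eigenvectorBasis i x = hA.eigenvectorBasis i y := by
    refine G.lapMatrix_mulVec_eq_zero_iff_forall_reachable.1 ?_ x y (hconn.preconnected x y)
    rw [heig, hi]; simp
  have hmem : (k : ℝ) ∈ spectrum ℝ (G.adjMatrix ℝ) := by
    rw [← Matrix.spectrum_toLin', ← Module.End.hasEigenvalue_iff_mem_spectrum]
    refine Module.End.hasEigenvalue_of_hasEigenvector (x := (1 : V → ℝ)) ⟨?_, ?_⟩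
    · rw [Module.End.mem_eigenspace_iff]
      have := aeval_adjMatrix_mulVec_one hreg X
      simpa using this
    · intro h
      have := congrFun h v₀
      simp at this
  rw [hA.spectrum_real_eq_range_eigenvalues] at hmem
  obtain ⟨i₀, hi₀⟩ := hmem
  refine ⟨i₀, hi₀, fun i hi => lt_of_le_of_ne (hle i) fun hik => ?_⟩
  have h0 := hA.eigenvectorBasis.inner_eq_zero hi
  have h1 (j : V) (hj : hA.eigenvalues j = k) : hA.eigenvectorBasis j v₀ ≠ 0 := by
    intro hz
    have hn := hA.eigenvectorBasis.norm_eq_one j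
    have : hA.eigenvectorBasis j = 0 := by
      ext x; rw [hconst j hj x v₀, hz]; rfl
    simp [this] at hn
  have h2 : (Fintype.card V : ℝ) *
      (hA.eigenvectorBasis i v₀ * hA.eigenvectorBasis i₀ v₀) = 0 := by
    rw [← h0, PiLp.inner_apply, Finset.sum_congr rfl (g := fun _ =>
      hA.eigenvectorBasis i v₀ * hA.eigenvectorBasis i₀ v₀)]
    · simp
    · intro x _
      rw [hconst i hik x v₀, hconst i₀ hi₀ x v₀]
      simp [mul_comm]
  have : Nonempty V := ⟨v₀⟩
  simp [h1 i hik, h1 i₀ hi₀] at h2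

/-- The second largest eigenvalue is the largest of the eigenvalues other than a maximal one. -/
lemma secondEigenvalue_spec {i₀ : V}
    (hmax : ∀ i, (adjMatrix_isHermitian G).eigenvalues i ≤
      (adjMatrix_isHermitian G).eigenvalues i₀) :
    (∀ i ≠ i₀, (adjMatrix_isHermitian G).eigenvalues i ≤ secondEigenvalue G) ∧
      (1 < Fintype.card V →
        ∃ i ≠ i₀, (adjMatrix_isHermitian G).eigenvalues i = secondEigenvalue G) ∧
      (Fintype.card V = 1 →
        (adjMatrix_isHermitian G).eigenvalues i₀ = secondEigenvalue G) := by
  set ev := (adjMatrix_isHermitian G).eigenvalues with hev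
  set M := (Finset.univ.erase i₀).val.map ev with hM
  have hcard : M.card = Fintype.card V - 1 := by
    rw [hM, Multiset.card_map, Finset.card_val, Finset.card_erase_of_mem (Finset.mem_univ _),
      Finset.card_univ]
  have hpos : 0 < Fintype.card V := Fintype.card_pos_iff.2 ⟨i₀⟩
  have hmem (a : ℝ) : a ∈ M.sort (· ≤ ·) ↔ ∃ i ≠ i₀, ev i = a := by
    simp only [Multiset.mem_sort, hM, Multiset.mem_map, Finset.mem_val, Finset.mem_erase,
      Finset.mem_univ, and_true]
  have hsort : (eigMultiset G).sort (· ≤ ·) = M.sort (· ≤ ·) ++ [ev i₀] := by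
    refine List.Perm.eq_of_pairwise' (r := (· ≤ ·)) (Multiset.pairwise_sort _ _) ?_ ?_
    · rw [List.pairwise_append]
      refine ⟨Multiset.pairwise_sort _ _, List.pairwise_singleton _ _, ?_⟩
      intro a ha b hb
      obtain ⟨i, -, rfl⟩ := (hmem a).1 ha
      rw [List.mem_singleton.1 hb]
      exact hmax i
    · rw [← Multiset.coe_eq_coe, Multiset.sort_eq, ← Multiset.coe_add, Multiset.sort_eq,
        eigMultiset, ← Finset.insert_erase (Finset.mem_univ i₀),
        Finset.insert_val_of_notMem (Finset.notMem_erase _ _), Multiset.map_cons,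
        Multiset.coe_singleton, add_comm, Multiset.singleton_add]
  have hlen : (M.sort (· ≤ ·)).length = Fintype.card V - 1 := by rw [Multiset.length_sort, hcard]
  have hsecond : secondEigenvalue G =
      (M.sort (· ≤ ·) ++ [ev i₀]).getD (Fintype.card V - 2) 0 := by
    rw [secondEigenvalue, hsort, List.length_append, hlen, List.length_singleton]
    congr 1
  have hbig (h : 1 < Fintype.card V) : secondEigenvalue G =
      (M.sort (· ≤ ·))[Fintype.card V - 2]'(by omega) := by
    rw [hsecond, List.getD_append _ _ _ _ (by omega), List.getD_eq_getElem]
  refine ⟨fun i hi => ?_, fun h => ?_, fun h => ?_⟩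
  · have h : 1 < Fintype.card V := Fintype.one_lt_card_iff.2 ⟨i, i₀, hi⟩
    obtain ⟨n, hn, hni⟩ := List.getElem_of_mem ((hmem _).2 ⟨i, hi, rfl⟩)
    rw [hbig h, ← hni]
    exact (Multiset.pairwise_sort M (· ≤ ·)).rel_get_of_le (a := ⟨n, hn⟩)
      (b := ⟨_, by omega⟩) (Fin.mk_le_mk.2 (by omega))
  · exact (hmem _).1 (hbig h ▸ List.getElem_mem _)
  · rw [hsecond]
    have : M.sort (· ≤ ·) = [] := List.length_eq_zero_iff.1 (by omega)
    simp [this, h]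

end Graph

section Spectral

variable {ι κ : Type*} [Fintype ι] [Fintype κ]

/-- The linear functional `p ↦ ∑ i, p (ev i)`. -/
noncomputable def evalSum (ev : ι → ℝ) : ℝ[X] →ₗ[ℝ] ℝ := ∑ i, leval (ev i)

lemma evalSum_apply (ev : ι → ℝ) (p : ℝ[X]) : evalSum ev p = ∑ i, p.eval (ev i) := by
  simp [evalSum, leval]

lemma evalSum_C_mul (ev : ι → ℝ) (c : ℝ) (p : ℝ[X]) : evalSum ev (C c * p) = c * evalSum ev p := by
  rw [← smul_eq_C_mul, map_smul, smul_eq_mul]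

lemma evalSum_mul_self_pos (ev : ι → ℝ) {p : ℝ[X]} (hp : p ≠ 0)
    (hdeg : p.natDegree < (Finset.univ.image ev).card) : 0 < evalSum ev (p * p) := by
  rw [evalSum_apply]
  by_contra hneg
  have hnn : ∀ i ∈ Finset.univ, 0 ≤ (p * p).eval (ev i) := fun i _ => by
    rw [eval_mul]; exact mul_self_nonneg _
  have hz := (Finset.sum_eq_zero_iff_of_nonneg hnn).1
    (le_antisymm (not_lt.1 hneg) (Finset.sum_nonneg hnn))
  refine hp (eq_zero_of_natDegree_lt_card_of_eval_eq_zero' p _ (fun x hx => ?_) hdeg)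
  obtain ⟨i, hi, rfl⟩ := Finset.mem_image.1 hx
  simpa using hz i hi

/-- A monic orthogonal polynomial is positive at the right end of the support of the measure. -/
lemma eval_pos_of_orthogonal (w ev : ι → ℝ) (hw : ∀ i, 0 ≤ w i) {τ : ℝ}
    (hτ : ∀ i, w i ≠ 0 → ev i ≤ τ) (T : Finset ℝ)
    (hT : ∀ t ∈ T, t < τ ∧ ∃ i, 0 < w i ∧ ev i = t) {P : ℝ[X]} (hP : P.Monic)
    (hdeg : P.natDegree ≤ T.card)
    (horth : ∀ r : ℝ[X], r.natDegree < P.natDegree → ∑ i, w i * (P * r).eval (ev i) = 0) :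
    0 < P.eval τ := by
  rcases Nat.eq_zero_or_pos P.natDegree with h0 | h0
  · rw [hP.natDegree_eq_zero.1 h0]; simp
  by_contra hneg
  obtain ⟨ρ, hρ, hroot⟩ : ∃ ρ, τ ≤ ρ ∧ P.eval ρ = 0 := by
    have htend := P.tendsto_atTop_of_leadingCoeff_nonneg (natDegree_pos_iff_degree_pos.1 h0)
      (by rw [hP.leadingCoeff]; exact zero_le_one)
    obtain ⟨b, hb, hb'⟩ := ((Filter.eventually_ge_atTop τ).and
      (htend.eventually_ge_atTop 0)).exists
    obtain ⟨ρ, hρ, h⟩ := intermediate_value_Icc hb P.continuous.continuousOn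
      ⟨not_lt.1 hneg, hb'⟩
    exact ⟨ρ, hρ.1, h⟩
  obtain ⟨R, hR⟩ := dvd_iff_isRoot.2 (show P.IsRoot ρ from hroot)
  have hRm : R.Monic := (monic_X_sub_C ρ).of_mul_monic_left (hR ▸ hP)
  have hRd : P.natDegree = 1 + R.natDegree := by
    rw [hR, (monic_X_sub_C ρ).natDegree_mul hRm, natDegree_X_sub_C]
  have hterm (i : ι) : w i * (P * R).eval (ev i) =
      -(w i * (ρ - ev i) * (R.eval (ev i) * R.eval (ev i))) := by
    rw [hR]; simp; ring
  have hnn : ∀ i ∈ Finset.univ, 0 ≤ w i * (ρ - ev i) * (R.eval (ev i) * R.eval (ev i)) := by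
    intro i _
    refine mul_nonneg ?_ (mul_self_nonneg _)
    by_cases hwi : w i = 0
    · simp [hwi]
    · exact mul_nonneg (hw i) (by linarith [hτ i hwi])
  have hsum := horth R (by omega)
  rw [Finset.sum_congr rfl fun i _ => hterm i, Finset.sum_neg_distrib, neg_eq_zero,
    Finset.sum_eq_zero_iff_of_nonneg hnn] at hsum
  refine hRm.ne_zero (eq_zero_of_natDegree_lt_card_of_eval_eq_zero' R T (fun t ht => ?_)
    (by omega))
  obtain ⟨htτ, i, hwi, rfl⟩ := hT t ht
  have := hsum i (Finset.mem_univ i)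
  have hne : ρ - ev i ≠ 0 := by linarith
  simpa [hwi.ne', hne] using this

/-- The cone of nonnegative combinations of `F_0, …, F_m`. -/
def FpolyCone (k m : ℕ) : Set ℝ[X] :=
  {p | ∃ c : ℕ → ℝ, (∀ i ≤ m, 0 ≤ c i) ∧ p = ∑ i ∈ Finset.range (m + 1), C (c i) * Fpoly k i}

/-- Comparison of two functionals on products of elements of the cones. -/
lemma le_of_mem_FpolyCone {k a b : ℕ} {L L' : ℝ[X] →ₗ[ℝ] ℝ}
    (h : ∀ i ≤ a, ∀ j ≤ b, L (Fpoly k i * Fpoly k j) ≤ L' (Fpoly k i * Fpoly k j))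
    {p r : ℝ[X]} (hp : p ∈ FpolyCone k a) (hr : r ∈ FpolyCone k b) : L (p * r) ≤ L' (p * r) := by
  obtain ⟨c, hc, rfl⟩ := hp
  obtain ⟨e, he, rfl⟩ := hr
  simp only [Finset.sum_mul_sum, map_sum]
  refine Finset.sum_le_sum fun i hi => Finset.sum_le_sum fun j hj => ?_
  have hia : i ≤ a := Nat.lt_succ_iff.1 (Finset.mem_range.1 hi)
  have hjb : j ≤ b := Nat.lt_succ_iff.1 (Finset.mem_range.1 hj)
  have e1 : C (c i) * Fpoly k i * (C (e j) * Fpoly k j) =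
      (c i * e j) • (Fpoly k i * Fpoly k j) := by
    rw [smul_eq_C_mul, C_mul]; ring
  rw [e1, map_smul, map_smul]
  exact mul_le_mul_of_nonneg_left (h i hia j hjb) (mul_nonneg (hc i hia) (he j hjb))

/-- Nonnegative combinations of the `G_j` are nonnegative combinations of the `F_i`. -/
lemma sum_Gpoly_mem_FpolyCone {k m : ℕ} {a : ℕ → ℝ} (ha : ∀ j ≤ m, 0 ≤ a j) :
    ∑ j ∈ Finset.range (m + 1), C (a j) * Gpoly k j ∈ FpolyCone k m := by
  refine ⟨fun i => ∑ j ∈ Finset.range (m + 1), if i ≤ j then a j else 0, fun i _ => ?_, ?_⟩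
  · refine Finset.sum_nonneg fun j hj => ?_
    split_ifs
    · exact ha j (Nat.lt_succ_iff.1 (Finset.mem_range.1 hj))
    · exact le_rfl
  · simp only [map_sum, Finset.sum_mul]
    rw [Finset.sum_comm]
    refine Finset.sum_congr rfl fun j hj => ?_
    rw [Gpoly, Finset.mul_sum]
    have hsub : Finset.range (j + 1) ⊆ Finset.range (m + 1) :=
      Finset.range_subset_range.2 (Finset.mem_range.1 hj)
    rw [← Finset.sum_subset hsub]
    · refine Finset.sum_congr rfl fun i hi => ?_
      rw [if_pos (Nat.lt_succ_iff.1 (Finset.mem_range.1 hi))]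
    · intro i _ hi
      rw [if_neg (fun h => hi (Finset.mem_range.2 (Nat.lt_succ_iff.2 h)))]
      simp

/-- The linear programming comparison: a spectrum with `e + 2` distinct values for which the `F_i`
are orthogonal up to degree `2 e + 1` minimises the second largest value. -/
lemma second_le_of_orthogonal {k e : ℕ} {n : ℝ} {ev : ι → ℝ} {ev' : κ → ℝ} {i₀ i₁ : ι} {j₀ : κ}
    {μ : ℝ} (hi₀ : ev i₀ = k) (hlt : ∀ i ≠ i₀, ev i < k)
    (hcard : (Finset.univ.image ev).card = e + 2) (hi₁ : i₁ ≠ i₀) (hmax : ∀ i ≠ i₀, ev i ≤ ev i₁)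
    (hL : ∀ i j, i + j ≤ 2 * e + 1 → evalSum ev (Fpoly k i * Fpoly k j) =
      if i = j then n * (Fpoly k i).eval (k : ℝ) else 0)
    (hj₀ : ev' j₀ = k) (hμ : ∀ j ≠ j₀, ev' j ≤ μ)
    (hL' : ∀ i j, (if i = j then n * (Fpoly k i).eval (k : ℝ) else 0) ≤
      evalSum ev' (Fpoly k i * Fpoly k j)) : ev i₁ ≤ μ := by
  classical
  set L := evalSum ev with hLdef
  set τ := ev i₁ with hτ
  have hτk : τ < k := hlt i₁ hi₁
  have hle (i : ι) : ev i ≤ k := by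
    by_cases h : i = i₀
    · rw [h, hi₀]
    · exact (hlt i h).le
  set T := ((Finset.univ.image ev).erase (k : ℝ)).erase τ with hTdef
  have hTcard : T.card = e := by
    rw [hTdef, Finset.card_erase_of_mem, Finset.card_erase_of_mem, hcard]
    · rfl
    · exact Finset.mem_image.2 ⟨i₀, Finset.mem_univ _, hi₀⟩
    · exact Finset.mem_erase.2 ⟨hτk.ne, Finset.mem_image.2 ⟨i₁, Finset.mem_univ _, rfl⟩⟩
  have hTmem (t : ℝ) (ht : t ∈ T) : t < τ ∧ ∃ i, ev i < k ∧ ev i = t := by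
    rw [hTdef, Finset.mem_erase, Finset.mem_erase, Finset.mem_image] at ht
    obtain ⟨h1, h2, i, -, rfl⟩ := ht
    have hi : i ≠ i₀ := fun h => h2 (h ▸ hi₀)
    exact ⟨lt_of_le_of_ne (hmax i hi) h1, i, hlt i hi, rfl⟩
  set h : ℝ[X] := ∏ t ∈ T, (X - C t) with hh
  have hmonic : h.Monic := monic_prod_of_monic _ _ fun t _ => monic_X_sub_C t
  have hdeg : h.natDegree = e := by
    rw [hh, natDegree_prod_of_monic _ _ fun t _ => monic_X_sub_C t]
    simp [hTcard]
  have hpos (x : ℝ) (hx : τ ≤ x) : 0 < h.eval x := by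
    rw [hh, eval_prod]
    refine Finset.prod_pos fun t ht => ?_
    have := (hTmem t ht).1
    simp; linarith
  have hzero (i : ι) (hi : i ≠ i₀) (hiτ : ev i ≠ τ) : h.eval (ev i) = 0 := by
    rw [hh, eval_prod]
    refine Finset.prod_eq_zero (i := ev i) ?_ (by simp)
    exact Finset.mem_erase.2 ⟨hiτ, Finset.mem_erase.2 ⟨(hlt i hi).ne,
      Finset.mem_image.2 ⟨i, Finset.mem_univ _, rfl⟩⟩⟩
  have hFpos (j : ℕ) (hj : j ≤ e) : 0 < n * (Fpoly k j).eval (k : ℝ) := by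
    have hF := Fpoly_monic_natDegree k j
    have := evalSum_mul_self_pos ev hF.1.ne_zero (by rw [hF.2, hcard]; omega)
    rwa [← hLdef, hL j j (by omega), if_pos rfl] at this
  have hnpos : 0 < n := by simpa [Fpoly] using hFpos 0 (Nat.zero_le _)
  have hrepr (j : ℕ) (hj : j ≤ e) (s : ℝ[X]) (hs : s.natDegree ≤ j) :
      L (Gpoly k j * s) = n * s.eval (k : ℝ) := by
    obtain ⟨c, -, hc⟩ := exists_eq_sum_of_monic (Fpoly_monic_natDegree k) j s hs
    rw [hc, Finset.mul_sum, map_sum, eval_finsetSum, Finset.mul_sum]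
    refine Finset.sum_congr rfl fun i hi => ?_
    have hij := Finset.mem_range.1 hi
    rw [mul_left_comm, evalSum_C_mul, Gpoly, Finset.sum_mul, map_sum,
      Finset.sum_eq_single_of_mem i hi, hL i i (by omega), if_pos rfl]
    · simp; ring
    · intro l hl hli
      have := Finset.mem_range.1 hl
      rw [hL l i (by omega), if_neg hli]
  have horth (j : ℕ) (hj : j ≤ e) (r : ℝ[X]) (hr : r.natDegree < j) :
      L ((C (k : ℝ) - X) * (Gpoly k j * r)) = 0 := by
    rw [mul_left_comm, hrepr j hj]
    · simp
    · have h1 := natDegree_mul_le (p := C (k : ℝ) - X) (q := r)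
      have h2 : (C (k : ℝ) - X).natDegree ≤ 1 := by
        rw [natDegree_sub, natDegree_X_sub_C]
      omega
  have hGpos (j : ℕ) (hj : j ≤ e) : 0 < (Gpoly k j).eval τ := by
    have hG := Gpoly_monic_natDegree k j
    refine eval_pos_of_orthogonal (fun i => (k : ℝ) - ev i) ev (fun i => sub_nonneg.2 (hle i))
      (fun i hi => hmax i fun h => hi (by rw [h, hi₀, sub_self])) T
      (fun t ht => ?_) hG.1 (by rw [hG.2, hTcard]; exact hj) (fun r hr => ?_)
    · obtain ⟨h1, i, h2, h3⟩ := hTmem t ht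
      exact ⟨h1, i, sub_pos.2 h2, h3⟩
    · rw [← horth j hj r (by rwa [hG.2] at hr), hLdef, evalSum_apply]
      simp
  have hcone : h ∈ FpolyCone k e := by
    obtain ⟨a, -, ha⟩ := exists_eq_sum_of_monic (Gpoly_monic_natDegree k) e h hdeg.le
    rw [ha]
    refine sum_Gpoly_mem_FpolyCone fun j hj => ?_
    have hleft : 0 < L ((C (k : ℝ) - X) * (h * Gpoly k j)) := by
      rw [hLdef, evalSum_apply]
      refine Finset.sum_pos' (fun i _ => ?_) ⟨i₁, Finset.mem_univ _, ?_⟩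
      · by_cases hi : i = i₀
        · simp [hi, hi₀]
        by_cases hiτ : ev i = τ
        · rw [hiτ]
          have := mul_pos (hpos τ le_rfl) (hGpos j hj)
          simpa using mul_nonneg (sub_nonneg.2 hτk.le) this.le
        · simp [hzero i hi hiτ]
      · have := mul_pos (hpos τ le_rfl) (hGpos j hj)
        simpa using mul_pos (sub_pos.2 hτk) this
    have hright : L ((C (k : ℝ) - X) * (h * Gpoly k j)) =
        a j * L ((C (k : ℝ) - X) * (Gpoly k j * Gpoly k j)) := by
      rw [ha, Finset.sum_mul, Finset.mul_sum, map_sum,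
        Finset.sum_eq_single_of_mem j (Finset.mem_range.2 (Nat.lt_succ_iff.2 hj))]
      · rw [mul_assoc, mul_left_comm, evalSum_C_mul]
      · intro i hi hij
        have hi' := Finset.mem_range.1 hi
        rw [mul_assoc, mul_left_comm, evalSum_C_mul]
        rcases lt_or_gt_of_ne hij with hlt' | hlt'
        · rw [mul_comm (Gpoly k i), horth j hj _ (by rwa [(Gpoly_monic_natDegree k i).2]), mul_zero]
        · rw [horth i (by omega) _ (by rwa [(Gpoly_monic_natDegree k j).2]), mul_zero]
    have hnn : 0 ≤ L ((C (k : ℝ) - X) * (Gpoly k j * Gpoly k j)) := by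
      rw [hLdef, evalSum_apply]
      refine Finset.sum_nonneg fun i _ => ?_
      simpa using mul_nonneg (sub_nonneg.2 (hle i)) (mul_self_nonneg _)
    rw [hright] at hleft
    exact (pos_of_mul_pos_left hleft hnn).le
  have hqcone : (X - C τ) * h ∈ FpolyCone k (e + 1) := by
    have hqm : ((X - C τ) * h).Monic := (monic_X_sub_C τ).mul hmonic
    have hqd : ((X - C τ) * h).natDegree = e + 1 := by
      rw [(monic_X_sub_C τ).natDegree_mul hmonic, hdeg, natDegree_X_sub_C, add_comm]
    obtain ⟨c, hctop, hc⟩ := exists_eq_sum_of_monic (Fpoly_monic_natDegree k) (e + 1) _ hqd.le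
    refine ⟨c, fun j hj => ?_, hc⟩
    rcases Nat.lt_or_ge e j with hje | hje
    · obtain rfl : j = e + 1 := by omega
      have := hqm.coeff_natDegree
      rw [hctop, ← hqd, this]
      exact zero_le_one
    · have h1 : L ((X - C τ) * h * Fpoly k j) =
          ((k : ℝ) - τ) * h.eval (k : ℝ) * (Fpoly k j).eval (k : ℝ) := by
        rw [hLdef, evalSum_apply, Finset.sum_eq_single_of_mem i₀ (Finset.mem_univ _)]
        · simp [hi₀]
        · intro i _ hi
          by_cases hiτ : ev i = τ
          · simp [hiτ]
          · simp [hzero i hi hiτ]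
      have h2 : L ((X - C τ) * h * Fpoly k j) = c j * (n * (Fpoly k j).eval (k : ℝ)) := by
        rw [hc, Finset.sum_mul, map_sum,
          Finset.sum_eq_single_of_mem j (Finset.mem_range.2 (by omega))]
        · rw [mul_assoc, evalSum_C_mul, hL j j (by omega), if_pos rfl]
        · intro i hi hij
          have hi' := Finset.mem_range.1 hi
          rw [mul_assoc, evalSum_C_mul, hL i j (by omega), if_neg hij, mul_zero]
      have hF : 0 < (Fpoly k j).eval (k : ℝ) := pos_of_mul_pos_right (hFpos j hje) hnpos.le
      have h3 : 0 < c j * (n * (Fpoly k j).eval (k : ℝ)) := by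
        rw [← h2, h1]
        exact mul_pos (mul_pos (sub_pos.2 hτk) (hpos _ hτk.le)) hF
      exact (pos_of_mul_pos_left h3 (hFpos j hje).le).le
  by_contra hcon
  have hμτ : μ < τ := not_le.1 hcon
  have hcmp : ∀ i ≤ e + 1, ∀ j ≤ e,
      L (Fpoly k i * Fpoly k j) ≤ evalSum ev' (Fpoly k i * Fpoly k j) := fun i hi j hj => by
    rw [hL i j (by omega)]; exact hL' i j
  have hq := le_of_mem_FpolyCone hcmp hqcone hcone
  have hh2 := le_of_mem_FpolyCone (fun i hi => hcmp i (by omega)) hcone hcone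
  have hsplit : (X - C μ) * (h * h) = (X - C τ) * h * h + C (τ - μ) * (h * h) := by
    rw [C_sub]; ring
  have hfle : L ((X - C μ) * (h * h)) ≤ evalSum ev' ((X - C μ) * (h * h)) := by
    rw [hsplit, map_add, map_add, evalSum_C_mul, evalSum_C_mul]
    exact add_le_add hq (mul_le_mul_of_nonneg_left hh2 (sub_pos.2 hμτ).le)
  have hfG : ((X - C μ) * (h * h)).eval (k : ℝ) < L ((X - C μ) * (h * h)) := by
    rw [hLdef, evalSum_apply, ← Finset.add_sum_erase _ _ (Finset.mem_univ i₀), hi₀]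
    refine lt_add_of_pos_right _ (Finset.sum_pos' (fun i hi => ?_)
      ⟨i₁, Finset.mem_erase.2 ⟨hi₁, Finset.mem_univ _⟩, ?_⟩)
    · by_cases hiτ : ev i = τ
      · rw [hiτ]
        simpa using mul_nonneg (sub_pos.2 hμτ).le (mul_self_nonneg (h.eval τ))
      · simp [hzero i (Finset.ne_of_mem_erase hi) hiτ]
    · have := hpos τ le_rfl
      simpa using mul_pos (sub_pos.2 hμτ) (mul_pos this this)
  have hfH : evalSum ev' ((X - C μ) * (h * h)) ≤ ((X - C μ) * (h * h)).eval (k : ℝ) := by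
    rw [evalSum_apply, ← Finset.add_sum_erase _ _ (Finset.mem_univ j₀), hj₀]
    refine add_le_of_nonpos_right (Finset.sum_nonpos fun j hj => ?_)
    simpa using mul_nonpos_of_nonpos_of_nonneg (sub_nonpos.2 (hμ j (Finset.ne_of_mem_erase hj)))
      (mul_self_nonneg (h.eval (ev' j)))
  linarith

end Spectral

theorem stmt3 {V : Type*} [Fintype V] [DecidableEq V] (k d : ℕ)
    (G : SimpleGraph V) [DecidableRel G.Adj]
    (hconn : G.Connected) (hreg : G.IsRegularOfDegree k)
    (hd : (Finset.image (adjMatrix_isHermitian G).eigenvalues Finset.univ).card = d + 1)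
    (hg : ((2 * d : ℕ) : ℕ∞) ≤ G.egirth) :
    ∀ (W : Type) [Fintype W] [DecidableEq W] (H : SimpleGraph W) [DecidableRel H.Adj],
      H.Connected → H.IsRegularOfDegree k → Fintype.card W = Fintype.card V →
      secondEigenvalue G ≤ secondEigenvalue H := by
  intro W _ _ H _ hHconn hHreg hcard
  obtain ⟨i₀, hi₀, hlt⟩ := exists_eigenvalues_eq_degree hconn hreg
  obtain ⟨j₀, hj₀, hlt'⟩ := exists_eigenvalues_eq_degree hHconn hHreg
  have hle (i : V) : (adjMatrix_isHermitian G).eigenvalues i ≤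
      (adjMatrix_isHermitian G).eigenvalues i₀ := by
    by_cases h : i = i₀
    · rw [h]
    · rw [hi₀]; exact (hlt i h).le
  have hle' (j : W) : (adjMatrix_isHermitian H).eigenvalues j ≤
      (adjMatrix_isHermitian H).eigenvalues j₀ := by
    by_cases h : j = j₀
    · rw [h]
    · rw [hj₀]; exact (hlt' j h).le
  obtain ⟨hmax, hex, hone⟩ := secondEigenvalue_spec hle
  obtain ⟨hmax', -, hone'⟩ := secondEigenvalue_spec hle'
  have hVpos : 0 < Fintype.card V := Fintype.card_pos_iff.2 ⟨i₀⟩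
  rcases Nat.lt_or_ge 1 (Fintype.card V) with hV | hV
  · obtain ⟨i₁, hi₁, hi₁'⟩ := hex hV
    obtain ⟨e, rfl⟩ : ∃ e, d = e + 1 := by
      refine ⟨d - 1, ?_⟩
      have : 1 < (Finset.image (adjMatrix_isHermitian G).eigenvalues Finset.univ).card :=
        Finset.one_lt_card.2 ⟨_, Finset.mem_image_of_mem _ (Finset.mem_univ i₀),
          _, Finset.mem_image_of_mem _ (Finset.mem_univ i₁), by rw [hi₀]; exact (hlt i₁ hi₁).ne'⟩
      omega
    have htrace (p : ℝ[X]) : (aeval (G.adjMatrix ℝ) p).trace =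
        evalSum (adjMatrix_isHermitian G).eigenvalues p := by
      rw [trace_aeval_eq_sum_eigenvalues, evalSum_apply]
    have hL := functional_Fpoly_mul (k := k) (M := 2 * e + 1) (v := Fintype.card V)
      (evalSum (adjMatrix_isHermitian G).eigenvalues) (by simp [evalSum_apply])
      (fun n hn hnM => by
        rw [← htrace]
        exact trace_aeval_Fpoly_of_lt_egirth hreg hn
          (lt_of_lt_of_le (by exact_mod_cast (by omega : n < 2 * (e + 1))) hg))
    rw [← hi₁']
    refine second_le_of_orthogonal hi₀ hlt hd hi₁ (fun i hi => hi₁' ▸ hmax i hi) hL hj₀ hmax'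
      fun i j => ?_
    rw [evalSum_apply, ← trace_aeval_eq_sum_eigenvalues, ← hcard]
    exact le_trace_aeval_Fpoly_mul hHreg i j
  · rw [← hone (by omega), ← hone' (by omega), hi₀, hj₀]
end

section
/- (Alon–Boppana, Serre.) For every integer k ≥ 3 and every real number λ < 2√(k−1), there exists a natural number N such that every connected k-regular finite simple graph whose second largest adjacency eigenvalue is at most λ has at most N vertices; in other words, there are only finitely many such graphs up to isomorphism. -/
open Polynomial

open scoped Matrix

theorem Multiset.card_filter_lt_le_one_of_sort_getD_le (s : Multiset ℝ) (c : ℝ)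
    (h : (s.sort (· ≤ ·)).getD ((s.sort (· ≤ ·)).length - 2) 0 ≤ c) :
    (s.filter (fun x => c < x)).card ≤ 1 := by
  have hs : ((s.sort (· ≤ ·) : List ℝ) : Multiset ℝ) = s := Multiset.sort_eq s _
  have hsorted : (s.sort (· ≤ ·)).Pairwise (· ≤ ·) := Multiset.pairwise_sort s _
  generalize s.sort (· ≤ ·) = L at *
  subst hs
  rw [Multiset.filter_coe, Multiset.coe_card]
  rcases Nat.lt_or_ge L.length 2 with hl | hl
  · exact (List.length_filter_le _ _).trans (by omega)
  · rw [List.getD_eq_getElem _ _ (by omega)] at h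
    rw [← List.take_append_drop (L.length - 1) L, List.filter_append, List.length_append]
    have h1 : (L.take (L.length - 1)).filter (fun x => decide (c < x)) = [] := by
      rw [List.filter_eq_nil_iff]
      intro a ha
      obtain ⟨i, hi, rfl⟩ := List.mem_iff_getElem.1 ha
      have hi' : i < L.length - 1 := by simpa using hi
      rw [List.getElem_take]
      have : L[i] ≤ L[L.length - 2] := by
        rcases Nat.lt_or_ge i (L.length - 2) with hlt | hge
        · exact List.pairwise_iff_getElem.1 hsorted _ _ _ _ hlt
        · have : i = L.length - 2 := by omega
          subst this
          exact le_rfl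
      simpa using this.trans h
    rw [h1]
    have h2 := List.length_filter_le (fun x => decide (c < x)) (L.drop (L.length - 1))
    rw [List.length_drop] at h2
    simp only [List.length_nil]
    omega

/-- All eigenvalues except at most one are bounded by any upper bound of the second largest. -/
theorem exists_forall_ne_eigenvalues_le {V : Type*} [Fintype V] [DecidableEq V] [Nonempty V]
    (G : SimpleGraph V) [DecidableRel G.Adj] {c : ℝ} (h : secondEigenvalue G ≤ c) :
    ∃ j, ∀ i, i ≠ j → (adjMatrix_isHermitian G).eigenvalues i ≤ c := by
  have h1 := Multiset.card_filter_lt_le_one_of_sort_getD_le (eigMultiset G) c h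
  rw [eigMultiset, Multiset.filter_map, Multiset.card_map] at h1
  have h2 : (Finset.univ.filter
      (fun i => c < (adjMatrix_isHermitian G).eigenvalues i)).card ≤ 1 := h1
  rw [Finset.card_le_one] at h2
  by_cases hex : ∃ j, c < (adjMatrix_isHermitian G).eigenvalues j
  · obtain ⟨j, hj⟩ := hex
    refine ⟨j, fun i hij => ?_⟩
    by_contra! hi
    exact hij (h2 i (by simpa using hi) j (by simpa using hj))
  · push Not at hex
    exact ⟨Classical.arbitrary V, fun i _ => hex i⟩

/-- If all eigenvalues of a real symmetric matrix except the `j`-th are at most `c`, its quadratic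
form is at most `c` times the squared norm on the orthogonal complement of the `j`-th eigenvector. -/
theorem Matrix.IsHermitian.dotProduct_mulVec_le {n : Type*} [Fintype n] [DecidableEq n]
    {A : Matrix n n ℝ} (hA : A.IsHermitian) {c : ℝ} {j : n}
    (hj : ∀ i, i ≠ j → hA.eigenvalues i ≤ c) {x : n → ℝ}
    (hx : ⇑(hA.eigenvectorBasis j) ⬝ᵥ x = 0) :
    x ⬝ᵥ A *ᵥ x ≤ c * (x ⬝ᵥ x) := by
  have expand (y z : n → ℝ) : y ⬝ᵥ z =
      ∑ i, (⇑(hA.eigenvectorBasis i) ⬝ᵥ y) * (⇑(hA.eigenvectorBasis i) ⬝ᵥ z) := by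
    have h := hA.eigenvectorBasis.sum_inner_mul_inner (WithLp.toLp 2 y) (WithLp.toLp 2 z)
    simp only [EuclideanSpace.inner_eq_star_dotProduct, star_trivial] at h
    rw [dotProduct_comm y z, ← h]
    exact Finset.sum_congr rfl fun i _ => by rw [dotProduct_comm z]
  have eig (i : n) : ⇑(hA.eigenvectorBasis i) ⬝ᵥ A *ᵥ x =
      hA.eigenvalues i * (⇑(hA.eigenvectorBasis i) ⬝ᵥ x) := by
    have hT : Aᵀ = A := by
      rw [← Matrix.conjTranspose_eq_transpose_of_trivial]
      exact hA
    rw [Matrix.dotProduct_mulVec, ← Matrix.mulVec_transpose, hT, hA.mulVec_eigenvectorBasis,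
      smul_dotProduct, smul_eq_mul]
  rw [expand x (A *ᵥ x), expand x x, Finset.mul_sum]
  refine Finset.sum_le_sum fun i _ => ?_
  rw [eig]
  by_cases hij : i = j
  · subst hij
    rw [hx]
    simp
  · nlinarith [mul_le_mul_of_nonneg_right (hj i hij)
      (mul_self_nonneg (⇑(hA.eigenvectorBasis i) ⬝ᵥ x))]

/-- If `f₁` and `f₂` have separated supports and satisfy `μ f ≤ A f` pointwise, the second largest
eigenvalue is at least `μ`. -/
theorem le_secondEigenvalue_of_separated {V : Type*} [Fintype V] [DecidableEq V]
    (G : SimpleGraph V) [DecidableRel G.Adj] {μ : ℝ} {f₁ f₂ : V → ℝ}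
    (pos₁ : ∀ x, 0 ≤ f₁ x) (pos₂ : ∀ x, 0 ≤ f₂ x)
    (le₁ : ∀ x, μ * f₁ x ≤ ∑ y ∈ G.neighborFinset x, f₁ y)
    (le₂ : ∀ x, μ * f₂ x ≤ ∑ y ∈ G.neighborFinset x, f₂ y)
    (disj : ∀ x, f₁ x = 0 ∨ f₂ x = 0) (sep : ∀ x y, G.Adj x y → f₁ x = 0 ∨ f₂ y = 0)
    (ne₁ : ∃ x, f₁ x ≠ 0) (ne₂ : ∃ x, f₂ x ≠ 0) :
    μ ≤ secondEigenvalue G := by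
  by_contra! hlt
  obtain ⟨u, hu⟩ := ne₁
  obtain ⟨v, hv⟩ := ne₂
  have : Nonempty V := ⟨u⟩
  obtain ⟨j, hj⟩ := exists_forall_ne_eigenvalues_le G le_rfl
  set e : V → ℝ := ⇑((adjMatrix_isHermitian G).eigenvectorBasis j)
  obtain ⟨a, b, hab, horth⟩ : ∃ a b : ℝ, (a ≠ 0 ∨ b ≠ 0) ∧ a * (e ⬝ᵥ f₁) + b * (e ⬝ᵥ f₂) = 0 := by
    by_cases h : e ⬝ᵥ f₁ = 0
    · exact ⟨1, 0, by simp, by simp [h]⟩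
    · exact ⟨e ⬝ᵥ f₂, -(e ⬝ᵥ f₁), Or.inr (neg_ne_zero.2 h), by ring⟩
  have hx : e ⬝ᵥ (a • f₁ + b • f₂) = 0 := by
    rw [dotProduct_add, dotProduct_smul, dotProduct_smul, smul_eq_mul, smul_eq_mul, horth]
  have upper := (adjMatrix_isHermitian G).dotProduct_mulVec_le hj hx
  set F : V → ℝ := a • f₁ + b • f₂ with hF
  have hFx (x : V) : F x = a * f₁ x + b * f₂ x := by simp [hF]
  have lower : μ * (F ⬝ᵥ F) ≤ F ⬝ᵥ G.adjMatrix ℝ *ᵥ F := by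
    simp only [dotProduct, Finset.mul_sum]
    refine Finset.sum_le_sum fun x _ => ?_
    rw [SimpleGraph.adjMatrix_mulVec_apply]
    simp only [hFx, Finset.sum_add_distrib, ← Finset.mul_sum]
    by_cases h₁ : f₁ x = 0
    · by_cases h₂ : f₂ x = 0
      · simp [h₁, h₂]
      · have hz : ∑ y ∈ G.neighborFinset x, f₁ y = 0 := Finset.sum_eq_zero fun y hy =>
          (sep y x ((G.mem_neighborFinset x y).1 hy).symm).resolve_right h₂
        rw [h₁, hz]
        nlinarith [mul_le_mul_of_nonneg_left (le₂ x) (mul_nonneg (mul_self_nonneg b) (pos₂ x))]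
    · have h₂ : f₂ x = 0 := (disj x).resolve_left h₁
      have hz : ∑ y ∈ G.neighborFinset x, f₂ y = 0 := Finset.sum_eq_zero fun y hy =>
        (sep x y ((G.mem_neighborFinset x y).1 hy)).resolve_left h₁
      rw [h₂, hz]
      nlinarith [mul_le_mul_of_nonneg_left (le₁ x) (mul_nonneg (mul_self_nonneg a) (pos₁ x))]
  have hne : ∃ x, F x ≠ 0 := by
    rcases hab with h | h
    · exact ⟨u, by simp [hFx, (disj u).resolve_left hu, h, hu]⟩
    · exact ⟨v, by simp [hFx, (disj v).resolve_right hv, h, hv]⟩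
  have hpos : 0 < F ⬝ᵥ F := by
    obtain ⟨x, hx⟩ := hne
    exact Finset.sum_pos' (fun y _ => mul_self_nonneg _)
      ⟨x, Finset.mem_univ x, mul_self_pos.2 hx⟩
  nlinarith [mul_lt_mul_of_pos_right hlt hpos]

theorem SimpleGraph.Connected.eq_or_exists_adj_dist_le {V : Type*} {G : SimpleGraph V}
    (hconn : G.Connected) {u v : V} {n : ℕ} (h : G.dist u v ≤ n + 1) :
    u = v ∨ ∃ w, G.Adj v w ∧ G.dist u w ≤ n := by
  obtain ⟨p, hp⟩ := hconn.exists_walk_length_eq_dist v u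
  cases p with
  | nil => exact Or.inl rfl
  | cons hadj p =>
    refine Or.inr ⟨_, hadj, ?_⟩
    rw [Walk.length_cons, dist_comm] at hp
    rw [dist_comm]
    exact (dist_le p).trans (by omega)

/-- Balls of radius `n` in a `k`-regular connected graph have at most `(k + 1) ^ n` vertices. -/
theorem SimpleGraph.IsRegularOfDegree.card_dist_le {V : Type*} [Fintype V] [DecidableEq V]
    {G : SimpleGraph V} [DecidableRel G.Adj] {k : ℕ} (hreg : G.IsRegularOfDegree k)
    (hconn : G.Connected) (u : V) (n : ℕ) :
    (Finset.univ.filter (fun v => G.dist u v ≤ n)).card ≤ (k + 1) ^ n := by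
  induction n with
  | zero =>
    simp [hconn.dist_eq_zero_iff, Finset.filter_eq]
  | succ n ih =>
    have hsub : Finset.univ.filter (fun v => G.dist u v ≤ n + 1) ⊆
        (Finset.univ.filter (fun v => G.dist u v ≤ n)).biUnion
          (fun w => insert w (G.neighborFinset w)) := by
      intro v hv
      simp only [Finset.mem_filter, Finset.mem_univ, true_and] at hv
      simp only [Finset.mem_biUnion, Finset.mem_filter, Finset.mem_univ, true_and,
        Finset.mem_insert, mem_neighborFinset]
      rcases hconn.eq_or_exists_adj_dist_le hv with rfl | ⟨w, hadj, hw⟩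
      · exact ⟨u, by simp, Or.inl rfl⟩
      · exact ⟨w, hw, Or.inr hadj.symm⟩
    refine (Finset.card_le_card hsub).trans
      ((Finset.card_biUnion_le_card_mul _ _ (k + 1) ?_).trans ?_)
    · intro w _
      refine (Finset.card_insert_le _ _).trans ?_
      rw [G.card_neighborFinset_eq_degree, hreg w]
    · rw [pow_succ]
      exact Nat.mul_le_mul_right _ ih

/-- A nonincreasing radial profile on the `(q + 1)`-regular tree with finite support on which the
adjacency operator acts as at least `μ`, for `μ` below the spectral radius `2 √q` of the tree. -/
theorem exists_radial_profile {q μ : ℝ} (hq : 1 ≤ q) (hμ : 0 < μ) (hμq : μ < 2 * √q) :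
    ∃ (g : ℕ → ℝ) (R : ℕ), Antitone g ∧ g 0 = 1 ∧ (∀ i, R < i → g i = 0) ∧
      μ * g 0 ≤ (q + 1) * g 1 ∧ ∀ i, μ * g (i + 1) ≤ g i + q * g (i + 2) := by
  have hq0 : 0 < q := by linarith
  have hsq : √q * √q = q := Real.mul_self_sqrt hq0.le
  have hμ1 : μ ≤ q + 1 := by nlinarith [sq_nonneg (√q - 1)]
  have hμ4 : μ ^ 2 < 4 * q := by nlinarith [Real.sqrt_nonneg q]
  -- The exact recursion, as a sequence of consecutive pairs.
  let p : ℕ → ℝ × ℝ := fun n =>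
    Nat.rec (1, μ / (q + 1)) (fun _ z => (z.2, (μ * z.2 - z.1) / q)) n
  let a : ℕ → ℝ := fun n => (p n).1
  have a0 : a 0 = 1 := rfl
  have a1 : a 1 = μ / (q + 1) := rfl
  have arec (n : ℕ) : a (n + 2) = (μ * a (n + 1) - a n) / q := rfl
  clear_value a
  clear p
  have step (n : ℕ) (hpos : ∀ i ≤ n, 0 < a i) : a (n + 1) ≤ a n := by
    induction n with
    | zero =>
      rw [a0, a1, div_le_one (by linarith)]
      exact hμ1
    | succ n ih =>
      have h := ih fun i hi => hpos i (by omega)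
      have := hpos (n + 1) le_rfl
      rw [arec, div_le_iff₀ hq0]
      nlinarith
  have hex : ∃ n, a n ≤ 0 := by
    by_contra! hpos
    set δ : ℝ := (1 - μ ^ 2 / (4 * q)) / q with hδ
    have hδ0 : 0 < δ := by
      apply div_pos _ hq0
      rw [sub_pos, div_lt_one (by linarith)]
      exact hμ4
    have hratio (n : ℕ) : a (n + 1) / a n ≤ 1 - n * δ := by
      induction n with
      | zero =>
        simpa using (div_le_one (hpos 0)).2 (step 0 fun i _ => hpos i)
      | succ n ih =>
        have hr1 : a (n + 1) / a n ≤ 1 := (div_le_one (hpos n)).2 (step n fun i _ => hpos i)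
        have hr0 : 0 < a (n + 1) / a n := div_pos (hpos _) (hpos _)
        have hr : a (n + 2) / a (n + 1) = (μ - (a (n + 1) / a n)⁻¹) / q := by
          rw [arec]
          have := (hpos n).ne'
          have := (hpos (n + 1)).ne'
          field_simp
        generalize a (n + 1) / a n = r at *
        have key : (μ - r⁻¹) / q ≤ r - δ := by
          have h1 : δ * q = 1 - μ ^ 2 / (4 * q) := by rw [hδ]; field_simp
          have h2 : 0 ≤ q * r ^ 2 - μ * r + μ ^ 2 / (4 * q) := by
            have : q * r ^ 2 - μ * r + μ ^ 2 / (4 * q) = (2 * q * r - μ) ^ 2 / (4 * q) := by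
              field_simp
              ring
            rw [this]
            positivity
          rw [div_le_iff₀ hq0]
          have h3 : r * r⁻¹ = 1 := mul_inv_cancel₀ hr0.ne'
          have h4 : δ * q * r ≤ δ * q := mul_le_of_le_one_right (by positivity) hr1
          refine le_of_mul_le_mul_left ?_ hr0
          nlinarith
        rw [show n + 1 + 1 = n + 2 from rfl, hr]
        push_cast
        linarith
    obtain ⟨n, hn⟩ := exists_nat_gt (1 / δ)
    rw [div_lt_iff₀ hδ0] at hn
    linarith [hratio n, div_pos (hpos (n + 1)) (hpos n)]
  classical
  obtain ⟨m, hm, hmin⟩ : ∃ m, a m ≤ 0 ∧ ∀ i < m, 0 < a i :=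
    ⟨Nat.find hex, Nat.find_spec hex, fun i hi => not_le.1 (Nat.find_min hex hi)⟩
  have hm0 : 0 < m := by
    rcases Nat.eq_zero_or_pos m with h | h
    · subst h
      linarith
    · exact h
  have hge (i : ℕ) (hi : i ≤ m) : a i ≤ if i < m then a i else 0 := by
    split_ifs with h
    · exact le_rfl
    · rwa [show i = m by omega]
  refine ⟨fun i => if i < m then a i else 0, m - 1, antitone_nat_of_succ_le fun n => ?_, ?_,
    fun i hi => if_neg (by omega), ?_, fun i => ?_⟩
  · by_cases h : n + 1 < m
    · simp only [h, if_true, show n < m by omega]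
      exact step n fun i hi => hmin i (by omega)
    · simp only [h, if_false]
      split_ifs with h'
      · exact (hmin n h').le
      · exact le_rfl
  · simp [hm0, a0]
  · have h1 := hge 1 hm0
    simp only [hm0, if_true, a0]
    have : (q + 1) * a 1 = μ := by
      rw [a1]
      field_simp
    nlinarith
  · by_cases h : i + 1 < m
    · have h1 := hge (i + 2) h
      simp only [h, if_true, show i < m by omega]
      have : q * a (i + 2) = μ * a (i + 1) - a i := by
        rw [arec]
        field_simp
      nlinarith
    · simp only [h, if_false, show ¬ i + 2 < m by omega]
      split_ifs with h'
      · simpa using (hmin i h').le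
      · simp

/-- A radial profile that is a subsolution on the tree is one on every connected regular graph. -/
theorem SimpleGraph.IsRegularOfDegree.mul_le_sum_neighborFinset_radial {V : Type*} [Fintype V]
    [DecidableEq V] {G : SimpleGraph V} [DecidableRel G.Adj] {k : ℕ}
    (hreg : G.IsRegularOfDegree k) (hconn : G.Connected) {g : ℕ → ℝ} {μ : ℝ} (hanti : Antitone g)
    (h0 : μ * g 0 ≤ k * g 1) (hstep : ∀ i, μ * g (i + 1) ≤ g i + ((k : ℝ) - 1) * g (i + 2))
    (u x : V) :
    μ * g (G.dist u x) ≤ ∑ y ∈ G.neighborFinset x, g (G.dist u y) := by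
  have hdeg : (G.neighborFinset x).card = k := by rw [G.card_neighborFinset_eq_degree, hreg x]
  have hle (y : V) (hy : y ∈ G.neighborFinset x) : g (G.dist u x + 1) ≤ g (G.dist u y) := by
    apply hanti
    have := hconn.dist_triangle (u := u) (v := x) (w := y)
    rwa [dist_eq_one_iff_adj.2 ((G.mem_neighborFinset x y).1 hy)] at this
  rcases hd : G.dist u x with _ | i
  · rw [hd] at hle
    refine h0.trans ?_
    have := Finset.card_nsmul_le_sum _ _ _ hle
    rwa [hdeg, nsmul_eq_mul] at this
  · rw [hd] at hle
    obtain ⟨w, hadj, hw⟩ := (hconn.eq_or_exists_adj_dist_le hd.le).resolve_left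
      (by rintro rfl; simp at hd)
    have hmem : w ∈ G.neighborFinset x := (G.mem_neighborFinset x w).2 hadj
    rw [← Finset.add_sum_erase _ _ hmem]
    refine (hstep i).trans (add_le_add (hanti hw) ?_)
    have := Finset.card_nsmul_le_sum ((G.neighborFinset x).erase w) (fun y => g (G.dist u y)) _
      fun y hy => hle y (Finset.mem_of_mem_erase hy)
    rwa [Finset.card_erase_of_mem hmem, hdeg, nsmul_eq_mul,
      Nat.cast_pred (hdeg ▸ Finset.card_pos.2 ⟨w, hmem⟩)] at this

theorem stmt12 (k : ℕ) (hk : 3 ≤ k) (lam : ℝ) (hlam : lam < 2 * Real.sqrt ((k : ℝ) - 1)) :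
    ∃ N : ℕ, ∀ (V : Type) [Fintype V] [DecidableEq V] (G : SimpleGraph V) [DecidableRel G.Adj],
      G.Connected → G.IsRegularOfDegree k → secondEigenvalue G ≤ lam →
      Fintype.card V ≤ N := by
  have hk' : (3 : ℝ) ≤ k := by exact_mod_cast hk
  have hsqrt : 0 < √((k : ℝ) - 1) := Real.sqrt_pos.2 (by linarith)
  obtain ⟨μ, hμ, hμk⟩ := exists_between (max_lt hlam (by linarith : 0 < 2 * √((k : ℝ) - 1)))
  obtain ⟨hlamμ, hμ0⟩ := max_lt_iff.1 hμ
  obtain ⟨g, R, hanti, hg0, hgR, h0, hstep⟩ :=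
    exists_radial_profile (by linarith : (1 : ℝ) ≤ (k : ℝ) - 1) hμ0 hμk
  rw [sub_add_cancel] at h0
  refine ⟨(k + 1) ^ (2 * R + 1), fun V _ _ G _ hconn hreg hsec => ?_⟩
  by_contra! hcard
  obtain ⟨u⟩ := hconn.nonempty
  obtain ⟨v, hv⟩ : ∃ v, 2 * R + 1 < G.dist u v := by
    by_contra! hall
    have := hreg.card_dist_le hconn u (2 * R + 1)
    rw [Finset.filter_true_of_mem fun v _ => hall v, Finset.card_univ] at this
    omega
  have hpos (i : ℕ) : 0 ≤ g i :=
    (hgR (max i (R + 1)) (by omega)).symm.le.trans (hanti (le_max_left i (R + 1)))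
  have hsep (x y : V) (hxy : G.dist x y ≤ 1) : g (G.dist u x) = 0 ∨ g (G.dist v y) = 0 := by
    by_contra! hne
    have hx : G.dist u x ≤ R := by
      by_contra! h
      exact hne.1 (hgR _ h)
    have hy : G.dist v y ≤ R := by
      by_contra! h
      exact hne.2 (hgR _ h)
    have h1 := hconn.dist_triangle (u := u) (v := x) (w := v)
    have h2 := hconn.dist_triangle (u := x) (v := y) (w := v)
    rw [G.dist_comm (u := y)] at h2
    omega
  have hle := le_secondEigenvalue_of_separated G (f₁ := fun x => g (G.dist u x))
    (f₂ := fun x => g (G.dist v x)) (fun _ => hpos _) (fun _ => hpos _)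
    (hreg.mul_le_sum_neighborFinset_radial hconn hanti h0 hstep u)
    (hreg.mul_le_sum_neighborFinset_radial hconn hanti h0 hstep v)
    (fun x => hsep x x (by simp))
    (fun x y hxy => hsep x y (SimpleGraph.dist_eq_one_iff_adj.2 hxy).le)
    ⟨u, by simp [hg0]⟩ ⟨v, by simp [hg0]⟩
  linarith
end
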